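/- arXiv:2502.10926 — 7 statements merged into one kernel-verified Lean document; each statement's English description precedes it below -/
import Mathlib

section
/- Let k be an algebraically closed field of characteristic 0 and n ≥ 2. Consider the action of GL_n(k) on the space V(n) = k^{n×n} × k^{n×n} of pairs of n×n matrices by simultaneous conjugation, T·(A,B) = (T^{-1}AT, T^{-1}BT). Then there is no constructible subset N of V(n) that meets every orbit of this action in exactly one point. That is, there do not exist finitely many families, each consisting of finitely many polynomials p_{i,1}, …, p_{i,t_i} and one polynomial h_i in the 2n² matrix entries, such that the set N = ⋃_i { (A,B) ∈ V(n) : p_{i,1}(A,B) = ⋯ = p_{i,t_i}(A,B) = 0 and h_i(A,B) ≠ 0 } contains exactly one point of each simultaneous-conjugation orbit. -/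
/-- Evaluation point for polynomials in the `2n²` entries of a pair of `n × n` matrices. -/
def pairEntries {k : Type*} [Field k] {n : ℕ}
    (C : Matrix (Fin n) (Fin n) k × Matrix (Fin n) (Fin n) k) :
    (Fin n × Fin n) ⊕ (Fin n × Fin n) → k :=
  Sum.elim (fun e => C.1 e.1 e.2) (fun e => C.2 e.1 e.2)

open MvPolynomial in
/-- A point over an extension of an algebraically closed field `k` specializes to a `k`-point
lying outside a prescribed hypersurface. -/
theorem exists_specialization {k K σ : Type*} [Field k] [IsAlgClosed k] [Field K] [Algebra k K]
    [Finite σ] (x : σ → K) (q : MvPolynomial σ k) (hq : aeval x q ≠ 0) :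
    ∃ x₀ : σ → k, (∀ p : MvPolynomial σ k, aeval x p = 0 → aeval x₀ p = 0) ∧
      aeval x₀ q ≠ 0 := by
  have hP : (RingHom.ker (aeval x : MvPolynomial σ k →ₐ[k] K)).IsPrime := RingHom.ker_isPrime _
  by_contra! H
  refine hq ?_
  rw [← RingHom.mem_ker, ← IsPrime.vanishingIdeal_zeroLocus (K := k) (RingHom.ker (aeval x)),
    mem_vanishingIdeal_iff]
  exact fun x₀ hx₀ => H x₀ fun p hp => hx₀ p hp

open MvPolynomial in
/-- If `h` vanishes on all geometric generic zeros of an ideal `I` of polynomials over a domain,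
then `I` contains a nonzero scalar multiple of a power of `h`. -/
theorem exists_C_mul_pow_mem {R L K σ : Type*} [CommRing R] [IsDomain R] [Field L] [Algebra R L]
    [IsFractionRing R L] [Field K] [IsAlgClosed K] [Algebra L K] [Algebra R K]
    [IsScalarTower R L K] [Finite σ] (I : Ideal (MvPolynomial σ R)) (h : MvPolynomial σ R)
    (H : ∀ x : σ → K, (∀ p ∈ I, aeval x p = 0) → aeval x h = 0) :
    ∃ g : R, g ≠ 0 ∧ ∃ N : ℕ, C g * h ^ N ∈ I := by
  let _ : Algebra (MvPolynomial σ R) (MvPolynomial σ L) := algebraMvPolynomial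
  have key (x : σ → K) (p : MvPolynomial σ R) :
      aeval x (algebraMap (MvPolynomial σ R) (MvPolynomial σ L) p) = aeval x p := by
    rw [MvPolynomial.algebraMap_def, aeval_map_algebraMap]
  have hrad : algebraMap (MvPolynomial σ R) (MvPolynomial σ L) h ∈
      (I.map (algebraMap (MvPolynomial σ R) (MvPolynomial σ L))).radical := by
    rw [← vanishingIdeal_zeroLocus_eq_radical (K := K), mem_vanishingIdeal_iff]
    intro x hx
    rw [key]
    refine H x fun p hp => ?_
    rw [← key]
    exact hx _ (Ideal.mem_map_of_mem _ hp)
  obtain ⟨N, hN⟩ := hrad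
  rw [← map_pow, IsLocalization.algebraMap_mem_map_algebraMap_iff
    ((nonZeroDivisors R).map (C (σ := σ)))] at hN
  obtain ⟨_, ⟨g, hg, rfl⟩, hm⟩ := hN
  exact ⟨g, nonZeroDivisors.ne_zero hg, N, hm⟩

/-- Apply a ring homomorphism to all entries of a pair of matrices. -/
def pairMap {R S : Type*} [CommRing R] [CommRing S] {n : ℕ} (f : R →+* S)
    (C : Matrix (Fin n) (Fin n) R × Matrix (Fin n) (Fin n) R) :
    Matrix (Fin n) (Fin n) S × Matrix (Fin n) (Fin n) S :=
  (f.mapMatrix C.1, f.mapMatrix C.2)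

/-- Simultaneous conjugacy of pairs of matrices over a commutative ring. -/
def SimConj {R : Type*} [CommRing R] {n : ℕ}
    (A C : Matrix (Fin n) (Fin n) R × Matrix (Fin n) (Fin n) R) : Prop :=
  ∃ T U : Matrix (Fin n) (Fin n) R, T * U = 1 ∧ U * A.1 * T = C.1 ∧ U * A.2 * T = C.2

theorem SimConj.map {R S : Type*} [CommRing R] [CommRing S] {n : ℕ} (f : R →+* S)
    {A C : Matrix (Fin n) (Fin n) R × Matrix (Fin n) (Fin n) R} (h : SimConj A C) :
    SimConj (pairMap f A) (pairMap f C) := by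
  obtain ⟨T, U, h1, h2, h3⟩ := h
  exact ⟨f.mapMatrix T, f.mapMatrix U, by rw [← map_mul, h1, map_one],
    by simp only [pairMap, ← map_mul, h2], by simp only [pairMap, ← map_mul, h3]⟩

theorem SimConj.symm {R : Type*} [CommRing R] {n : ℕ}
    {A C : Matrix (Fin n) (Fin n) R × Matrix (Fin n) (Fin n) R} (h : SimConj A C) :
    SimConj C A := by
  obtain ⟨T, U, h1, h2, h3⟩ := h
  have conj (M : Matrix (Fin n) (Fin n) R) : T * (U * M * T) * U = M := by
    calc T * (U * M * T) * U = (T * U) * M * (T * U) := by simp only [mul_assoc]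
      _ = M := by simp [h1]
  exact ⟨U, T, mul_eq_one_comm.mp h1, by rw [← h2, conj], by rw [← h3, conj]⟩

theorem SimConj.trans {R : Type*} [CommRing R] {n : ℕ}
    {A C D : Matrix (Fin n) (Fin n) R × Matrix (Fin n) (Fin n) R} (h : SimConj A C)
    (h' : SimConj C D) : SimConj A D := by
  obtain ⟨T, U, h1, h2, h3⟩ := h
  obtain ⟨T', U', h1', h2', h3'⟩ := h'
  refine ⟨T * T', U' * U, ?_, ?_, ?_⟩
  · rw [mul_assoc, ← mul_assoc T', h1', one_mul, h1]
  · rw [← h2', ← h2]; simp only [mul_assoc]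
  · rw [← h3', ← h3]; simp only [mul_assoc]

/-- The points over an extension `K` of the constructible set defined over `k` by the families
`p` of equations and `h` of inequations. -/
def InCells {k : Type*} (K : Type*) [Field k] [Field K] [Algebra k K] {n r : ℕ} {t : Fin r → ℕ}
    (p : (i : Fin r) → Fin (t i) → MvPolynomial ((Fin n × Fin n) ⊕ (Fin n × Fin n)) k)
    (h : Fin r → MvPolynomial ((Fin n × Fin n) ⊕ (Fin n × Fin n)) k)
    (C : Matrix (Fin n) (Fin n) K × Matrix (Fin n) (Fin n) K) : Prop :=
  ∃ i, (∀ j, MvPolynomial.aeval (pairEntries C) (p i j) = 0) ∧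
    MvPolynomial.aeval (pairEntries C) (h i) ≠ 0

theorem InCells.map {k K : Type*} [Field k] [Field K] [Algebra k K] {n r : ℕ} {t : Fin r → ℕ}
    {p : (i : Fin r) → Fin (t i) → MvPolynomial ((Fin n × Fin n) ⊕ (Fin n × Fin n)) k}
    {h : Fin r → MvPolynomial ((Fin n × Fin n) ⊕ (Fin n × Fin n)) k}
    {C : Matrix (Fin n) (Fin n) K × Matrix (Fin n) (Fin n) K} (f : K →ₐ[k] K)
    (hC : InCells K p h C) : InCells K p h (pairMap (f : K →+* K) C) := by
  have hE : pairEntries (pairMap (f : K →+* K) C) = fun e => f (pairEntries C e) := by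
    funext e; rcases e with e | e <;> rfl
  obtain ⟨i, h1, h2⟩ := hC
  refine ⟨i, fun j => ?_, ?_⟩
  · rw [hE, ← MvPolynomial.comp_aeval_apply, h1, map_zero]
  · rw [hE, ← MvPolynomial.comp_aeval_apply]
    exact (map_ne_zero f).mpr h2

/-- The `a`-th of a family of generic `n × n` matrices. -/
noncomputable def genericMatrix (R : Type*) [CommRing R] {m : ℕ} (n : ℕ) (a : Fin m) :
    Matrix (Fin n) (Fin n) (MvPolynomial (Fin m × Fin n × Fin n) R) :=
  Matrix.of fun i j => MvPolynomial.X (a, i, j)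

theorem pairEntries_generic {R K : Type*} [CommRing R] [Field K] [Algebra R K] {m n : ℕ}
    (a b : Fin m) (x : Fin m × Fin n × Fin n → K) {k : Type*} [Field k] [Algebra k R]
    [Algebra k K] [IsScalarTower k R K]
    (q : MvPolynomial ((Fin n × Fin n) ⊕ (Fin n × Fin n)) k) :
    MvPolynomial.aeval x (MvPolynomial.aeval (Sum.elim
      (fun e => genericMatrix R n a e.1 e.2) (fun e => genericMatrix R n b e.1 e.2)) q) =
    MvPolynomial.aeval (pairEntries
      (Matrix.of fun i j => x (a, i, j), Matrix.of fun i j => x (b, i, j))) q := by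
  have := MvPolynomial.comp_aeval_apply (R := k) (σ := (Fin n × Fin n) ⊕ (Fin n × Fin n))
    (f := (Sum.elim (fun e => genericMatrix R n a e.1 e.2)
      (fun e => genericMatrix R n b e.1 e.2)))
    ((MvPolynomial.aeval x : MvPolynomial (Fin m × Fin n × Fin n) R →ₐ[R] K).restrictScalars k) q
  refine this.trans ?_
  congr 2
  funext e
  rcases e with e | e <;> simp [pairEntries, genericMatrix]

theorem mapMatrix_generic {R K : Type*} [CommRing R] [CommRing K] [Algebra R K] {m n : ℕ}
    (a : Fin m) (x : Fin m × Fin n × Fin n → K) :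
    (MvPolynomial.aeval x : _ →ₐ[R] K).toRingHom.mapMatrix (genericMatrix R n a) =
      Matrix.of fun i j => x (a, i, j) := by
  ext i j
  simp [genericMatrix]

theorem InCells.eq_of_simConj {k K : Type*} [Field k] [IsAlgClosed k] [Field K] [Algebra k K]
    {n r : ℕ} {t : Fin r → ℕ}
    {p : (i : Fin r) → Fin (t i) → MvPolynomial ((Fin n × Fin n) ⊕ (Fin n × Fin n)) k}
    {h : Fin r → MvPolynomial ((Fin n × Fin n) ⊕ (Fin n × Fin n)) k}
    (hk : ∀ C C' : Matrix (Fin n) (Fin n) k × Matrix (Fin n) (Fin n) k,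
      InCells k p h C → InCells k p h C' → SimConj C C' → C = C')
    {C C' : Matrix (Fin n) (Fin n) K × Matrix (Fin n) (Fin n) K}
    (hC : InCells K p h C) (hC' : InCells K p h C') (hconj : SimConj C C') : C = C' := by
  by_contra hne
  obtain ⟨i, hi, hi'⟩ := hC
  obtain ⟨j, hj, hj'⟩ := hC'
  obtain ⟨T, U, hTU, hA, hB⟩ := hconj
  obtain ⟨e, he⟩ : ∃ e, pairEntries C e ≠ pairEntries C' e := by
    by_contra! H
    exact hne (Prod.ext (Matrix.ext fun a b => H (Sum.inl (a, b)))
      (Matrix.ext fun a b => H (Sum.inr (a, b))))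
  let x : Fin 6 × Fin n × Fin n → K := fun z => ![C.1, C.2, C'.1, C'.2, T, U] z.1 z.2.1 z.2.2
  let G (a : Fin 6) := genericMatrix k n a
  let E := (Sum.elim (fun e => G 0 e.1 e.2) (fun e => G 1 e.1 e.2) :
    ((Fin n × Fin n) ⊕ (Fin n × Fin n)) → _)
  let E' := (Sum.elim (fun e => G 2 e.1 e.2) (fun e => G 3 e.1 e.2) :
    ((Fin n × Fin n) ⊕ (Fin n × Fin n)) → _)
  have hE (q : MvPolynomial ((Fin n × Fin n) ⊕ (Fin n × Fin n)) k) : MvPolynomial.aeval x (MvPolynomial.aeval E q) =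
      MvPolynomial.aeval (pairEntries C) q := pairEntries_generic (R := k) 0 1 x q
  have hE' (q : MvPolynomial ((Fin n × Fin n) ⊕ (Fin n × Fin n)) k) : MvPolynomial.aeval x (MvPolynomial.aeval E' q) =
      MvPolynomial.aeval (pairEntries C') q := pairEntries_generic (R := k) 2 3 x q
  obtain ⟨x₀, hx₀, hq⟩ := exists_specialization (k := k) x
    (MvPolynomial.aeval E (h i) * MvPolynomial.aeval E' (h j) *
      (MvPolynomial.aeval E (MvPolynomial.X e) - MvPolynomial.aeval E' (MvPolynomial.X e))) (by
      rw [map_mul, map_mul, map_sub, hE, hE', hE, hE', MvPolynomial.aeval_X, MvPolynomial.aeval_X]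
      exact mul_ne_zero (mul_ne_zero hi' hj') (sub_ne_zero.mpr he))
  let M (a : Fin 6) : Matrix (Fin n) (Fin n) k := Matrix.of fun i j => x₀ (a, i, j)
  have hF (q : MvPolynomial ((Fin n × Fin n) ⊕ (Fin n × Fin n)) k) : MvPolynomial.aeval x₀ (MvPolynomial.aeval E q) =
      MvPolynomial.aeval (pairEntries (M 0, M 1)) q := pairEntries_generic (R := k) 0 1 x₀ q
  have hF' (q : MvPolynomial ((Fin n × Fin n) ⊕ (Fin n × Fin n)) k) : MvPolynomial.aeval x₀ (MvPolynomial.aeval E' q) =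
      MvPolynomial.aeval (pairEntries (M 2, M 3)) q := pairEntries_generic (R := k) 2 3 x₀ q
  have hM (a : Fin 6) : (MvPolynomial.aeval x₀ : _ →ₐ[k] k).toRingHom.mapMatrix (G a) = M a :=
    mapMatrix_generic a x₀
  have hG (a : Fin 6) : (MvPolynomial.aeval x : _ →ₐ[k] K).toRingHom.mapMatrix (G a) =
      ![C.1, C.2, C'.1, C'.2, T, U] a := mapMatrix_generic a x
  have transfer (P Q : Matrix (Fin n) (Fin n) (MvPolynomial (Fin 6 × Fin n × Fin n) k))
      (hPQ : (MvPolynomial.aeval x : _ →ₐ[k] K).toRingHom.mapMatrix P =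
        (MvPolynomial.aeval x : _ →ₐ[k] K).toRingHom.mapMatrix Q) :
      (MvPolynomial.aeval x₀ : _ →ₐ[k] k).toRingHom.mapMatrix P =
        (MvPolynomial.aeval x₀ : _ →ₐ[k] k).toRingHom.mapMatrix Q := by
    ext a b
    have h1 := congrFun (congrFun hPQ a) b
    have h2 := hx₀ (P a b - Q a b) (by rw [map_sub]; exact sub_eq_zero.mpr h1)
    rw [map_sub] at h2
    exact sub_eq_zero.mp h2
  rw [map_mul, map_mul, map_sub, hF, hF', hF, hF', MvPolynomial.aeval_X, MvPolynomial.aeval_X]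
    at hq
  have hqe := right_ne_zero_of_mul hq
  have hqh := left_ne_zero_of_mul hq
  refine sub_ne_zero.mp hqe (congrArg (fun D => pairEntries D e)
    (hk (M 0, M 1) (M 2, M 3) ⟨i, fun l => ?_, left_ne_zero_of_mul hqh⟩
      ⟨j, fun l => ?_, right_ne_zero_of_mul hqh⟩ ⟨M 4, M 5, ?_, ?_, ?_⟩))
  · rw [← hF]; exact hx₀ _ (by rw [hE, hi])
  · rw [← hF']; exact hx₀ _ (by rw [hE', hj])
  · have := transfer (G 4 * G 5) 1 (by rw [map_mul, hG, hG, map_one]; exact hTU)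
    rwa [map_mul, hM, hM, map_one] at this
  · have := transfer (G 5 * G 0 * G 4) (G 2)
      (by rw [map_mul, map_mul, hG, hG, hG, hG]; exact hA)
    rwa [map_mul, map_mul, hM, hM, hM, hM] at this
  · have := transfer (G 5 * G 1 * G 4) (G 3)
      (by rw [map_mul, map_mul, hG, hG, hG, hG]; exact hB)
    rwa [map_mul, map_mul, hM, hM, hM, hM] at this

/-- The ideal of polynomials in four generic matrices `C₀, C₁, T, U` expressing that `(C₀, C₁)`
satisfies the equations `q` and is the conjugate by `T = U⁻¹` of the pair `A`. -/
noncomputable def conjIdeal {k R ι : Type*} [Field k] [CommRing R] [Algebra k R] {n : ℕ}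
    (q : ι → MvPolynomial ((Fin n × Fin n) ⊕ (Fin n × Fin n)) k)
    (A : Matrix (Fin n) (Fin n) R × Matrix (Fin n) (Fin n) R) :
    Ideal (MvPolynomial (Fin 4 × Fin n × Fin n) R) :=
  let G (a : Fin 4) := genericMatrix R n a
  let c (B : Matrix (Fin n) (Fin n) R) : Matrix (Fin n) (Fin n)
    (MvPolynomial (Fin 4 × Fin n × Fin n) R) := MvPolynomial.C.mapMatrix B
  Ideal.span (Set.range (fun j => MvPolynomial.aeval (Sum.elim
      (fun e => genericMatrix R n 0 e.1 e.2) (fun e => genericMatrix R n 1 e.1 e.2)) (q j)) ∪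
    (Set.range (fun z : Fin n × Fin n => (G 2 * G 3 - 1) z.1 z.2) ∪
    (Set.range (fun z : Fin n × Fin n =>
      (G 3 * c A.1 * G 2 - G 0) z.1 z.2) ∪
    Set.range (fun z : Fin n × Fin n =>
      (G 3 * c A.2 * G 2 - G 1) z.1 z.2))))

theorem forall_mem_conjIdeal_iff {k R F ι : Type*} [Field k] [CommRing R] [Algebra k R] [Field F]
    [Algebra R F] [Algebra k F] [IsScalarTower k R F] {n : ℕ}
    (q : ι → MvPolynomial ((Fin n × Fin n) ⊕ (Fin n × Fin n)) k)
    (A : Matrix (Fin n) (Fin n) R × Matrix (Fin n) (Fin n) R)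
    (M : Fin 4 → Matrix (Fin n) (Fin n) F) :
    (∀ f ∈ conjIdeal q A, MvPolynomial.aeval (fun z => M z.1 z.2.1 z.2.2) f = 0) ↔
      (∀ j, MvPolynomial.aeval (pairEntries (M 0, M 1)) (q j) = 0) ∧ M 2 * M 3 = 1 ∧
      M 3 * (pairMap (algebraMap R F) A).1 * M 2 = M 0 ∧
      M 3 * (pairMap (algebraMap R F) A).2 * M 2 = M 1 := by
  let ev : MvPolynomial (Fin 4 × Fin n × Fin n) R →ₐ[R] F :=
    MvPolynomial.aeval (fun z => M z.1 z.2.1 z.2.2)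
  have hG (a : Fin 4) : ev.toRingHom.mapMatrix (genericMatrix R n a) = M a :=
    mapMatrix_generic a _
  have hA (B : Matrix (Fin n) (Fin n) R) :
      ev.toRingHom.mapMatrix (MvPolynomial.C.mapMatrix B) = (algebraMap R F).mapMatrix B := by
    ext i j
    simp [ev]
  have hmat (P Q : Matrix (Fin n) (Fin n) (MvPolynomial (Fin 4 × Fin n × Fin n) R)) :
      (∀ z : Fin n × Fin n, ev ((P - Q) z.1 z.2) = 0) ↔
        ev.toRingHom.mapMatrix P = ev.toRingHom.mapMatrix Q := by
    rw [← Matrix.ext_iff, Prod.forall]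
    refine forall₂_congr fun i j => ?_
    rw [Matrix.sub_apply, map_sub, sub_eq_zero]
    rfl
  have hspan : (∀ f ∈ conjIdeal q A, ev f = 0) ↔ conjIdeal q A ≤ RingHom.ker ev := Iff.rfl
  refine hspan.trans ?_
  rw [conjIdeal, Ideal.span_le]
  simp only [Set.union_subset_iff, Set.range_subset_iff, SetLike.mem_coe, RingHom.mem_ker, hmat,
    map_mul, map_one, hG, hA]
  refine and_congr (forall_congr' fun j => ?_) Iff.rfl
  rw [show ev _ = _ from pairEntries_generic 0 1 _ (q j)]
  rfl

theorem exists_inCells_simConj {k R L K : Type*} [Field k] [CommRing R] [IsDomain R]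
    [Algebra k R] [Field L] [Algebra R L] [IsFractionRing R L] [Field K] [IsAlgClosed K]
    [Algebra L K] [Algebra R K] [IsScalarTower R L K] [Algebra k K] [IsScalarTower k R K]
    {n r : ℕ} {t : Fin r → ℕ}
    {p : (i : Fin r) → Fin (t i) → MvPolynomial ((Fin n × Fin n) ⊕ (Fin n × Fin n)) k}
    {h : Fin r → MvPolynomial ((Fin n × Fin n) ⊕ (Fin n × Fin n)) k}
    (hk : ∀ A : Matrix (Fin n) (Fin n) k × Matrix (Fin n) (Fin n) k,
      ∃ C, InCells k p h C ∧ SimConj A C)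
    (hR : ∀ g : R, g ≠ 0 → ∃ φ : R →ₐ[k] k, φ g ≠ 0)
    (A : Matrix (Fin n) (Fin n) R × Matrix (Fin n) (Fin n) R) :
    ∃ C, InCells K p h C ∧ SimConj (pairMap (algebraMap R K) A) C := by
  by_contra! H
  let E := (Sum.elim (fun e => genericMatrix R n (0 : Fin 4) e.1 e.2)
    (fun e => genericMatrix R n 1 e.1 e.2) : ((Fin n × Fin n) ⊕ (Fin n × Fin n)) → _)
  have hg (i : Fin r) : ∃ g : R, g ≠ 0 ∧ ∃ N : ℕ,
      MvPolynomial.C g * MvPolynomial.aeval E (h i) ^ N ∈ conjIdeal (p i) A := by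
    refine exists_C_mul_pow_mem (L := L) (K := K) _ _ fun x hx => ?_
    obtain ⟨h1, h2, h3, h4⟩ := (forall_mem_conjIdeal_iff (p i) A
      (fun a => Matrix.of fun i j => x (a, i, j))).mp hx
    by_contra h5
    rw [pairEntries_generic] at h5
    exact H _ ⟨i, h1, h5⟩ ⟨_, _, h2, h3, h4⟩
  choose g hg0 N hN using hg
  obtain ⟨φ, hφ⟩ := hR (∏ i, g i) (Finset.prod_ne_zero_iff.mpr fun i _ => hg0 i)
  let _ : Algebra R k := φ.toRingHom.toAlgebra
  have : IsScalarTower k R k := .of_algebraMap_eq fun c => (φ.commutes c).symm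
  obtain ⟨C, ⟨i, hi, hi'⟩, T, U, hTU, h1, h2⟩ := hk (pairMap (algebraMap R k) A)
  have hz := (forall_mem_conjIdeal_iff (p i) A ![C.1, C.2, T, U]).mpr ⟨hi, hTU, h1, h2⟩ _ (hN i)
  rw [map_mul, map_pow, pairEntries_generic, MvPolynomial.aeval_C] at hz
  refine mul_ne_zero ?_ (pow_ne_zero _ hi') hz
  rw [map_prod] at hφ
  exact Finset.prod_ne_zero_iff.mp hφ i (Finset.mem_univ i)
/-- The diagonal matrix with entries `s, ζ s, ζ² s, …`. -/
def clockMatrix {R : Type*} [CommRing R] (n : ℕ) (ζ s : R) : Matrix (Fin n) (Fin n) R :=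
  Matrix.diagonal fun i => ζ ^ (i : ℕ) * s

/-- The cyclic shift `e₀ ↦ e₁ ↦ ⋯ ↦ eₙ₋₁ ↦ y e₀`. -/
def shiftMatrix {R : Type*} [CommRing R] (n : ℕ) [NeZero n] (y : R) :
    Matrix (Fin n) (Fin n) R :=
  Matrix.of fun i j => if i = j + 1 then (if i = 0 then y else 1) else 0

theorem pairMap_clock_shift {R S : Type*} [CommRing R] [CommRing S] {n : ℕ} [NeZero n]
    (f : R →+* S) (ζ s y : R) :
    pairMap f (clockMatrix n ζ s, shiftMatrix n y) =
      (clockMatrix n (f ζ) (f s), shiftMatrix n (f y)) := by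
  refine Prod.ext ?_ ?_
  · ext i j
    simp [pairMap, clockMatrix, Matrix.diagonal_apply]
  · ext i j
    simp [pairMap, shiftMatrix, apply_ite f]

theorem Fin.pow_val_add_one {R : Type*} [Monoid R] {n : ℕ} [NeZero n] {ζ : R} (hζ : ζ ^ n = 1)
    (j : Fin n) : ζ ^ ((j + 1 : Fin n) : ℕ) = ζ ^ (j : ℕ) * ζ := by
  rw [← pow_succ, Fin.val_add, pow_eq_pow_mod ((j : ℕ) + 1) hζ, Fin.val_one', Nat.add_mod_mod]

theorem clockMatrix_mul_shiftMatrix {R : Type*} [CommRing R] {n : ℕ} [NeZero n] {ζ : R}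
    (hζ : ζ ^ n = 1) (s y : R) :
    clockMatrix n ζ s * shiftMatrix n y = shiftMatrix n y * clockMatrix n ζ (ζ * s) := by
  ext i j
  rw [clockMatrix, clockMatrix, Matrix.diagonal_mul, Matrix.mul_diagonal, shiftMatrix,
    Matrix.of_apply]
  split_ifs with h h'
  · rw [h, Fin.pow_val_add_one hζ]; ring
  · rw [h, Fin.pow_val_add_one hζ]; ring
  · simp

theorem exists_shiftMatrix_mul_eq_one {K : Type*} [Field K] {n : ℕ} [NeZero n] {y : K}
    (hy : y ≠ 0) : ∃ U : Matrix (Fin n) (Fin n) K, shiftMatrix n y * U = 1 := by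
  refine ⟨Matrix.of fun i j => if j = i + 1 then (if j = 0 then y⁻¹ else 1) else 0, ?_⟩
  ext i l
  rw [Matrix.mul_apply, Finset.sum_eq_single (i - 1)]
  · by_cases hil : i = l
    · subst hil
      by_cases hi : i = 0 <;> simp [shiftMatrix, hi, hy]
    · simp [shiftMatrix, hil, Ne.symm hil]
  · intro j _ hj
    have : i ≠ j + 1 := fun h => hj (by simp [h])
    simp [shiftMatrix, this]
  · simp

/-- The pairs for `s` and `ζ s` are conjugate, by the shift matrix itself. -/
theorem simConj_clock_shift {K : Type*} [Field K] {n : ℕ} [NeZero n] {ζ : K} (hζ : ζ ^ n = 1)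
    (s : K) {y : K} (hy : y ≠ 0) :
    SimConj (clockMatrix n ζ s, shiftMatrix n y) (clockMatrix n ζ (ζ * s), shiftMatrix n y) := by
  obtain ⟨U, hU⟩ := exists_shiftMatrix_mul_eq_one (n := n) hy
  refine ⟨shiftMatrix n y, U, hU, ?_, ?_⟩
  · rw [mul_assoc, clockMatrix_mul_shiftMatrix hζ, ← mul_assoc, mul_eq_one_comm.mp hU, one_mul]
  · rw [mul_eq_one_comm.mp hU, one_mul]

theorem clockMatrix_mulVec_single_zero {R : Type*} [CommRing R] {n : ℕ} [NeZero n] (ζ s : R) :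
    (clockMatrix n ζ s).mulVec (Pi.single 0 1) = s • Pi.single 0 1 := by
  ext i
  rw [clockMatrix, Matrix.mulVec_diagonal]
  by_cases h : i = 0
  · simp [h]
  · simp [h]

theorem eq_smul_single_of_clockMatrix_mulVec {K : Type*} [Field K] {n : ℕ} [NeZero n] {ζ s : K}
    (hζ : IsPrimitiveRoot ζ n) (hs : s ≠ 0) {w : Fin n → K}
    (hw : (clockMatrix n ζ s).mulVec w = s • w) : w = w 0 • Pi.single 0 1 := by
  ext i
  by_cases h : i = 0
  · simp [h]
  · have h1 := congrFun hw i
    rw [clockMatrix, Matrix.mulVec_diagonal, Pi.smul_apply, smul_eq_mul] at h1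
    have h2 : (ζ ^ (i : ℕ) - 1) * (s * w i) = 0 := by linear_combination h1
    have h3 : ζ ^ (i : ℕ) - 1 ≠ 0 :=
      sub_ne_zero.mpr (hζ.pow_ne_one_of_pos_of_lt (fun h0 => h (Fin.ext h0)) i.isLt)
    simpa [h, h3, hs] using h2

theorem shiftMatrix_mulVec_single {R : Type*} [CommRing R] {n : ℕ} [NeZero n] (y : R)
    (j : Fin n) : (shiftMatrix n y).mulVec (Pi.single j 1) =
      (if j + 1 = 0 then y else 1) • Pi.single (j + 1) 1 := by
  ext i
  rw [Matrix.mulVec_single_one]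
  by_cases h : i = j + 1
  · simp [shiftMatrix, h]
  · simp [shiftMatrix, h]

theorem shiftMatrix_pow_mulVec_single_zero {R : Type*} [CommRing R] {n : ℕ} [NeZero n] (y : R) :
    (shiftMatrix n y ^ n).mulVec (Pi.single 0 1) = y • Pi.single 0 1 := by
  have key (m : ℕ) (hm : m < n) :
      (shiftMatrix n y ^ m).mulVec (Pi.single 0 1) = Pi.single (Fin.ofNat n m) 1 := by
    induction m with
    | zero => rw [pow_zero, Matrix.one_mulVec]; simp
    | succ m ih =>
      have hne : Fin.ofNat n m + 1 ≠ 0 := by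
        intro h
        have h' := congrArg Fin.val h
        simp [Fin.val_add, Nat.mod_eq_of_lt hm] at h'
      rw [pow_succ', ← Matrix.mulVec_mulVec, ih (by omega), shiftMatrix_mulVec_single, if_neg hne,
        one_smul]
      congr 1
      ext
      simp [Fin.val_add]
  obtain ⟨m, hm⟩ := Nat.exists_eq_succ_of_ne_zero (NeZero.ne n)
  have hz : Fin.ofNat n m + 1 = 0 := by
    ext
    rw [Fin.val_add, Fin.val_ofNat, Fin.val_one', Nat.mod_add_mod, Nat.add_mod_mod,
      ← Nat.succ_eq_add_one, ← hm, Nat.mod_self, Fin.val_zero]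
  have hpow : shiftMatrix n y ^ n = shiftMatrix n y * shiftMatrix n y ^ m := by
    rw [← pow_succ', ← Nat.succ_eq_add_one, ← hm]
  rw [hpow, ← Matrix.mulVec_mulVec, key m (by omega), shiftMatrix_mulVec_single, if_pos hz, hz]

/-- If a pair conjugate to the clock and shift matrices is fixed by an automorphism `σ` with
`σ s = ζ s`, then `y` is a norm for `σ` of an element that is as rational as the pair and `s`. -/
theorem exists_norm_eq_of_map_eq {K : Type*} [Field K] {n : ℕ} [NeZero n] {ζ s y : K}
    (hζ : IsPrimitiveRoot ζ n) (hs : s ≠ 0) (σ : K ≃+* K) (hσζ : σ ζ = ζ) (hσs : σ s = ζ * s)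
    {C : Matrix (Fin n) (Fin n) K × Matrix (Fin n) (Fin n) K}
    (hC : SimConj (clockMatrix n ζ s, shiftMatrix n y) C)
    (hσC : pairMap (σ : K →+* K) C = C) :
    ∃ f : K, (∀ g : K →+* K, pairMap g C = C → g s = s → g f = f) ∧
      ∏ i ∈ Finset.range n, σ^[i] f = y := by
  obtain ⟨T, U, hTU, h1, h2⟩ := hC
  dsimp only at h1 h2
  have hUT : U * T = 1 := mul_eq_one_comm.mp hTU
  -- The eigenvector of `C.1` for the eigenvalue `s`, and multiplicity one.
  let v₀ : Fin n → K := U.mulVec (Pi.single 0 1)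
  have hTv₀ : T.mulVec v₀ = Pi.single 0 1 := by
    rw [Matrix.mulVec_mulVec, hTU, Matrix.one_mulVec]
  have hv₀ : v₀ ≠ 0 := by
    intro h
    rw [h, Matrix.mulVec_zero] at hTv₀
    simpa using congrFun hTv₀ 0
  obtain ⟨i₀, hi₀⟩ : ∃ i, v₀ i ≠ 0 := Function.ne_iff.mp hv₀
  let v : Fin n → K := (v₀ i₀)⁻¹ • v₀
  have hv1 : v i₀ = 1 := by simp [v, hi₀]
  have hCv₀ : C.1.mulVec v₀ = s • v₀ := by
    rw [← h1, ← Matrix.mulVec_mulVec, hTv₀, ← Matrix.mulVec_mulVec,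
      clockMatrix_mulVec_single_zero, Matrix.mulVec_smul]
  have hCv : C.1.mulVec v = s • v := by
    rw [Matrix.mulVec_smul, hCv₀, smul_comm]
  have huniq (w : Fin n → K) (hw : C.1.mulVec w = s • w) : w = w i₀ • v := by
    have hTw : (clockMatrix n ζ s).mulVec (T.mulVec w) = s • T.mulVec w := by
      rw [← Matrix.mulVec_smul, ← hw, ← h1, Matrix.mulVec_mulVec, Matrix.mulVec_mulVec,
        ← mul_assoc, ← mul_assoc, hTU, one_mul]
    have h3 : w = (T.mulVec w) 0 • v₀ := by
      calc w = U.mulVec (T.mulVec w) := by rw [Matrix.mulVec_mulVec, hUT, Matrix.one_mulVec]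
        _ = _ := by
          rw [eq_smul_single_of_clockMatrix_mulVec hζ hs hTw, Matrix.mulVec_smul]
          simp [v₀]
    have h4 : w = ((T.mulVec w) 0 * v₀ i₀) • v := by
      simpa [v, smul_smul, hi₀] using h3
    have h5 := congrFun h4 i₀
    rw [Pi.smul_apply, hv1, smul_eq_mul, mul_one] at h5
    rw [h5]
    exact h4
  have hmap (g : K →+* K) (M : Matrix (Fin n) (Fin n) K) (hM : g.mapMatrix M = M)
      (w : Fin n → K) : M.mulVec (g ∘ w) = g ∘ M.mulVec w := by
    ext i
    rw [Function.comp_apply, RingHom.map_mulVec]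
    rw [RingHom.mapMatrix_apply] at hM
    rw [hM]
  have hfix (g : K →+* K) (hg : pairMap g C = C) (hgs : g s = s) : g ∘ v = v := by
    have h3 : C.1.mulVec (g ∘ v) = s • (g ∘ v) := by
      rw [hmap g _ (congrArg Prod.fst hg), hCv]
      ext i
      simp [hgs]
    have h4 := huniq _ h3
    rwa [Function.comp_apply, hv1, map_one, one_smul] at h4
  have hcomm : C.1 * C.2 = ζ • (C.2 * C.1) := by
    have h3 : clockMatrix n ζ (ζ * s) = ζ • clockMatrix n ζ s := by
      ext i j
      simp only [clockMatrix, Matrix.diagonal_apply, Matrix.smul_apply, smul_eq_mul]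
      split_ifs <;> ring
    calc C.1 * C.2 = U * clockMatrix n ζ s * (T * U) * shiftMatrix n y * T := by
          rw [← h1, ← h2]; simp only [mul_assoc]
      _ = ζ • (U * shiftMatrix n y * (T * U) * clockMatrix n ζ s * T) := by
          rw [hTU, mul_one, mul_one, mul_assoc U, clockMatrix_mul_shiftMatrix hζ.pow_eq_one, h3]
          simp only [Matrix.mul_smul, Matrix.smul_mul, mul_assoc]
      _ = ζ • (C.2 * C.1) := by
          rw [← h1, ← h2]; simp only [mul_assoc]
  have hBv : C.1.mulVec (C.2.mulVec v) = (ζ * s) • C.2.mulVec v := by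
    rw [Matrix.mulVec_mulVec, hcomm, Matrix.smul_mulVec, ← Matrix.mulVec_mulVec, hCv,
      Matrix.mulVec_smul, smul_smul]
  have hBσ : C.2.mulVec v = (C.2.mulVec v) i₀ • ((σ : K →+* K) ∘ v) := by
    have hσC' : (σ.symm : K →+* K).mapMatrix C.1 = C.1 := by
      ext i j
      have h3 : σ (C.1 i j) = C.1 i j := congrFun (congrFun (congrArg Prod.fst hσC) i) j
      exact σ.injective (by simpa using h3.symm)
    have h3 : σ.symm (ζ * s) = s := by rw [← hσs, σ.symm_apply_apply]
    have h4 := huniq ((σ.symm : K →+* K) ∘ C.2.mulVec v) (by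
      rw [hmap _ _ hσC', hBv]
      ext i
      simp only [Function.comp_apply, Pi.smul_apply, smul_eq_mul, RingEquiv.coe_toRingHom]
      rw [map_mul σ.symm, h3])
    ext i
    have h5 := congrArg σ (congrFun h4 i)
    simpa using h5
  refine ⟨(C.2.mulVec v) i₀, fun g hg hgs => ?_, ?_⟩
  · have h3 := hmap g _ (congrArg Prod.snd hg) v
    rw [hfix g hg hgs] at h3
    exact (congrFun h3 i₀).symm
  · let f := (C.2.mulVec v) i₀
    have hiterC (m : ℕ) : pairMap ((σ : K →+* K) ^ m) C = C := by
      induction m with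
      | zero => rfl
      | succ m ih =>
        have h3 : pairMap ((σ : K →+* K) ^ (m + 1)) C =
          pairMap ((σ : K →+* K) ^ m) (pairMap (σ : K →+* K) C) := rfl
        rw [h3, hσC, ih]
    have hpow (m : ℕ) : (C.2 ^ m).mulVec v =
        (∏ i ∈ Finset.range m, σ^[i] f) • (⇑((σ : K →+* K) ^ m) ∘ v) := by
      induction m with
      | zero => ext; simp
      | succ m ih =>
        rw [pow_succ', ← Matrix.mulVec_mulVec, ih, Matrix.mulVec_smul,
          hmap _ _ (congrArg Prod.snd (hiterC m)), hBσ, Finset.prod_range_succ, mul_smul]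
        congr 1
        ext i
        simp [f]
    have hiters (m : ℕ) : ((σ : K →+* K) ^ m) s = ζ ^ m * s := by
      induction m with
      | zero => simp
      | succ m ih =>
        rw [pow_succ', RingHom.mul_def, RingHom.comp_apply, ih]
        simp [hσζ, hσs, pow_succ, mul_assoc]
    have hn := hpow n
    rw [hfix _ (hiterC n) (by rw [hiters, hζ.pow_eq_one, one_mul])] at hn
    have hCn : C.2 ^ n = U * shiftMatrix n y ^ n * T := by
      have h3 (m : ℕ) : C.2 ^ m = U * shiftMatrix n y ^ m * T := by
        induction m with
        | zero => simp [hUT]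
        | succ m ih =>
          calc C.2 ^ (m + 1) = U * shiftMatrix n y ^ m * (T * U) * shiftMatrix n y * T := by
                rw [pow_succ, ih, ← h2]; simp only [mul_assoc]
            _ = _ := by rw [hTU, mul_one, mul_assoc U, ← pow_succ]
      exact h3 n
    have hyv : (C.2 ^ n).mulVec v = y • v := by
      rw [Matrix.mulVec_smul, hCn, ← Matrix.mulVec_mulVec, hTv₀, ← Matrix.mulVec_mulVec,
        shiftMatrix_pow_mulVec_single_zero, Matrix.mulVec_smul, smul_comm]
    rw [hyv] at hn
    simpa [hv1] using (congrFun hn i₀).symm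
open Polynomial in
/-- The automorphism `X ↦ ζ X` of `k[X][Y]`. -/
noncomputable def scaleEquiv {k : Type*} [Field k] (ζ : k) (hζ : ζ ≠ 0) : k[X][X] ≃+* k[X][X] :=
  letI := invertibleOfNonzero hζ
  Polynomial.mapEquiv (algEquivCMulXAddC ζ 0 : k[X] ≃ₐ[k] k[X]).toRingEquiv

open Polynomial in
theorem scaleEquiv_C_C {k : Type*} [Field k] (ζ : k) (hζ : ζ ≠ 0) (a : k) :
    scaleEquiv ζ hζ (C (C a)) = C (C a) := by
  simp [scaleEquiv]

open Polynomial in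
theorem scaleEquiv_C_X {k : Type*} [Field k] (ζ : k) (hζ : ζ ≠ 0) :
    scaleEquiv ζ hζ (C X) = C (C ζ) * C X := by
  simp [scaleEquiv]

open Polynomial in
theorem scaleEquiv_X {k : Type*} [Field k] (ζ : k) (hζ : ζ ≠ 0) :
    scaleEquiv ζ hζ X = X := by
  simp [scaleEquiv]

open Polynomial in
theorem natTrailingDegree_scaleEquiv {k : Type*} [Field k] (ζ : k) (hζ : ζ ≠ 0) (P : k[X][X]) :
    (scaleEquiv ζ hζ P).natTrailingDegree = P.natTrailingDegree := by
  let _ := invertibleOfNonzero hζ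
  have h : (scaleEquiv ζ hζ P).support = P.support :=
    support_map_of_injective P (algEquivCMulXAddC ζ 0 : k[X] ≃ₐ[k] k[X]).toRingEquiv.injective
  rw [natTrailingDegree, natTrailingDegree, trailingDegree, trailingDegree, h]

open Polynomial in
theorem iterate_scaleEquiv_ne_zero {k : Type*} [Field k] (ζ : k) (hζ : ζ ≠ 0) {P : k[X][X]}
    (hP : P ≠ 0) (i : ℕ) : (scaleEquiv ζ hζ)^[i] P ≠ 0 := by
  induction i with
  | zero => exact hP
  | succ i ih => rw [Function.iterate_succ_apply']; simpa using ih

open Polynomial in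
theorem natTrailingDegree_prod_iterate_scaleEquiv {k : Type*} [Field k] (ζ : k) (hζ : ζ ≠ 0)
    {P : k[X][X]} (hP : P ≠ 0) (m : ℕ) :
    (∏ i ∈ Finset.range m, (scaleEquiv ζ hζ)^[i] P).natTrailingDegree =
      m * P.natTrailingDegree := by
  have hne := iterate_scaleEquiv_ne_zero ζ hζ hP
  have hdeg (i : ℕ) : ((scaleEquiv ζ hζ)^[i] P).natTrailingDegree = P.natTrailingDegree := by
    induction i with
    | zero => rfl
    | succ i ih => rw [Function.iterate_succ_apply', natTrailingDegree_scaleEquiv, ih]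
  induction m with
  | zero => simp
  | succ m ih =>
    rw [Finset.prod_range_succ, natTrailingDegree_mul
      (Finset.prod_ne_zero_iff.mpr fun i _ => hne i) (hne m), ih, hdeg, add_mul, one_mul]

open Polynomial in
/-- The variable `Y` is not a norm for the automorphism `X ↦ ζ X` of the function field of
`k[X][Y]`. -/
theorem prod_iterate_ne_X {k K : Type*} [Field k] [Field K] [Algebra k[X][X] K]
    [FaithfulSMul k[X][X] K] {n : ℕ} (hn : 2 ≤ n) (ζ : k) (hζ : ζ ≠ 0) (σ : K ≃+* K)
    (hσ : ∀ P : k[X][X], σ (algebraMap _ K P) = algebraMap _ K (scaleEquiv ζ hζ P))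
    {P Q : k[X][X]} (hQ : Q ≠ 0) :
    ∏ i ∈ Finset.range n, σ^[i] (algebraMap _ K P / algebraMap _ K Q) ≠
      algebraMap k[X][X] K X := by
  have hinj : Function.Injective (algebraMap k[X][X] K) := FaithfulSMul.algebraMap_injective _ _
  have hiter (i : ℕ) (P : k[X][X]) :
      σ^[i] (algebraMap _ K P) = algebraMap _ K ((scaleEquiv ζ hζ)^[i] P) := by
    induction i with
    | zero => rfl
    | succ i ih => rw [Function.iterate_succ_apply', ih, hσ, Function.iterate_succ_apply']
  intro H
  have hdiv (i : ℕ) : σ^[i] (algebraMap _ K P / algebraMap _ K Q) =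
      algebraMap _ K ((scaleEquiv ζ hζ)^[i] P) / algebraMap _ K ((scaleEquiv ζ hζ)^[i] Q) := by
    rw [← hiter, ← hiter]
    have h := map_div₀ ((σ : K →+* K) ^ i) (algebraMap _ K P) (algebraMap _ K Q)
    rwa [RingHom.coe_pow] at h
  have hQn : ∏ i ∈ Finset.range n, (scaleEquiv ζ hζ)^[i] Q ≠ 0 :=
    Finset.prod_ne_zero_iff.mpr fun i _ => iterate_scaleEquiv_ne_zero ζ hζ hQ i
  simp only [hdiv, Finset.prod_div_distrib, ← map_prod] at H
  rw [div_eq_iff (by simpa using hinj.ne hQn), ← map_mul] at H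
  have H' := hinj H
  have hP : P ≠ 0 := by
    rintro rfl
    refine mul_ne_zero X_ne_zero hQn (H'.symm.trans ?_)
    exact Finset.prod_eq_zero (Finset.mem_range.mpr (by omega : 0 < n)) rfl
  have hdeg := congrArg natTrailingDegree H'
  rw [natTrailingDegree_mul X_ne_zero hQn, natTrailingDegree_prod_iterate_scaleEquiv ζ hζ hP,
    natTrailingDegree_prod_iterate_scaleEquiv ζ hζ hQ, natTrailingDegree_X] at hdeg
  have hdvd : n ∣ 1 := (Nat.dvd_add_left (dvd_mul_right n Q.natTrailingDegree)).mp
    (hdeg ▸ dvd_mul_right n P.natTrailingDegree)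
  have := Nat.le_of_dvd one_pos hdvd
  omega

open Polynomial in
theorem exists_algHom_ne_zero {k : Type*} [Field k] [Infinite k] (g : k[X][X]) (hg : g ≠ 0) :
    ∃ φ : k[X][X] →ₐ[k] k, φ g ≠ 0 := by
  obtain ⟨s, hs⟩ : ∃ s, eval s g.leadingCoeff ≠ 0 := by
    by_contra! H
    exact hg (leadingCoeff_eq_zero.mp (Polynomial.funext fun s => by rw [H, eval_zero]))
  have hmap : g.mapAlgHom (aeval s : k[X] →ₐ[k] k) ≠ 0 := by
    intro h
    have := congrArg (fun q => coeff q g.natDegree) h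
    simp at this
    exact hs (by simpa [Polynomial.coe_aeval_eq_eval] using this)
  obtain ⟨y, hy⟩ : ∃ y, eval y (mapAlgHom (aeval s : k[X] →ₐ[k] k) g) ≠ 0 := by
    by_contra! H
    exact hmap (Polynomial.funext fun y => by rw [H, eval_zero])
  exact ⟨(aeval y : k[X] →ₐ[k] k).comp (mapAlgHom (aeval s)), by simpa [aeval_def] using hy⟩
/-- over an algebraically closed field of characteristic `0` and for `n ≥ 2`,
the action of `GL_n(k)` on pairs of `n × n` matrices by simultaneous conjugation admits no
constructible set of normal forms: there is no finite family of locally closed sets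
`{p i 1 = ⋯ = p i tᵢ = 0, h i ≠ 0}` (cut out by polynomials in the `2n²` matrix entries)
whose union contains exactly one point of every simultaneous-conjugation orbit. -/
theorem stmt7 (k : Type*) [Field k] [IsAlgClosed k] [CharZero k] (n : ℕ) (hn : 2 ≤ n) :
    ¬ ∃ (r : ℕ) (t : Fin r → ℕ)
        (p : (i : Fin r) → Fin (t i) → MvPolynomial ((Fin n × Fin n) ⊕ (Fin n × Fin n)) k)
        (h : Fin r → MvPolynomial ((Fin n × Fin n) ⊕ (Fin n × Fin n)) k),
      ∀ AB : Matrix (Fin n) (Fin n) k × Matrix (Fin n) (Fin n) k,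
        ∃! C : Matrix (Fin n) (Fin n) k × Matrix (Fin n) (Fin n) k,
          (∃ i : Fin r, (∀ j, MvPolynomial.eval (pairEntries C) (p i j) = 0) ∧
            MvPolynomial.eval (pairEntries C) (h i) ≠ 0) ∧
          ∃ T : (Matrix (Fin n) (Fin n) k)ˣ,
            (↑T⁻¹ : Matrix (Fin n) (Fin n) k) * AB.1 * (↑T : Matrix (Fin n) (Fin n) k) = C.1 ∧
            (↑T⁻¹ : Matrix (Fin n) (Fin n) k) * AB.2 * (↑T : Matrix (Fin n) (Fin n) k) = C.2 := by
  rintro ⟨r, t, p, h, H⟩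
  have : NeZero n := ⟨by omega⟩
  have hex (A : Matrix (Fin n) (Fin n) k × Matrix (Fin n) (Fin n) k) :
      ∃ C, InCells k p h C ∧ SimConj A C := by
    obtain ⟨C, ⟨hC, T, h1, h2⟩, -⟩ := H A
    exact ⟨C, by simpa [InCells, MvPolynomial.coe_aeval_eq_eval] using hC,
      T, ↑T⁻¹, T.mul_inv, h1, h2⟩
  have huniq (C C' : Matrix (Fin n) (Fin n) k × Matrix (Fin n) (Fin n) k)
      (hC : InCells k p h C) (hC' : InCells k p h C') (hconj : SimConj C C') : C = C' := by
    obtain ⟨T, U, hTU, h1, h2⟩ := hconj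
    refine (H C).unique ⟨by simpa [InCells, MvPolynomial.coe_aeval_eq_eval] using hC, 1, ?_, ?_⟩
      ⟨by simpa [InCells, MvPolynomial.coe_aeval_eq_eval] using hC',
        ⟨T, U, hTU, mul_eq_one_comm.mp hTU⟩, h1, h2⟩ <;> simp
  obtain ⟨ζ, hζ⟩ := HasEnoughRootsOfUnity.exists_primitiveRoot k n
  have hζ0 : ζ ≠ 0 := hζ.ne_zero (NeZero.ne n)
  let R := Polynomial (Polynomial k)
  let L := FractionRing R
  let K := AlgebraicClosure L
  have hinj : Function.Injective (algebraMap R K) := by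
    rw [IsScalarTower.algebraMap_eq R L K]
    exact (algebraMap L K).injective.comp (IsFractionRing.injective R L)
  have : FaithfulSMul R K := (faithfulSMul_iff_algebraMap_injective R K).mpr hinj
  let σL : L ≃+* L := IsFractionRing.ringEquivOfRingEquiv (scaleEquiv ζ hζ0)
  let σ : K ≃+* K := IsAlgClosure.equivOfEquiv K K σL
  have hσ (P : R) : σ (algebraMap R K P) = algebraMap R K (scaleEquiv ζ hζ0 P) := by
    rw [IsScalarTower.algebraMap_apply R L K, IsScalarTower.algebraMap_apply R L K,
      IsAlgClosure.equivOfEquiv_algebraMap, IsFractionRing.ringEquivOfRingEquiv_algebraMap]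
  let s : K := algebraMap R K (Polynomial.C Polynomial.X)
  let y : K := algebraMap R K Polynomial.X
  have hk (a : k) : algebraMap R K (Polynomial.C (Polynomial.C a)) = algebraMap k K a :=
    (IsScalarTower.algebraMap_apply k R K a).symm
  have hζK : IsPrimitiveRoot (algebraMap k K ζ) n :=
    hζ.map_of_injective (algebraMap k K).injective
  have hσk (a : k) : σ (algebraMap k K a) = algebraMap k K a := by
    rw [← hk, hσ, scaleEquiv_C_C]
  have hσs : σ s = algebraMap k K ζ * s := by
    rw [hσ, scaleEquiv_C_X, map_mul, hk]
  have hσy : σ y = y := by rw [hσ, scaleEquiv_X]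
  have hs : s ≠ 0 :=
    (map_ne_zero_iff _ hinj).mpr (Polynomial.C_ne_zero.mpr Polynomial.X_ne_zero)
  have hy : y ≠ 0 := (map_ne_zero_iff _ hinj).mpr Polynomial.X_ne_zero
  obtain ⟨C, hC, hconj⟩ := exists_inCells_simConj (L := L) (K := K) hex exists_algHom_ne_zero
    (clockMatrix n (Polynomial.C (Polynomial.C ζ)) (Polynomial.C Polynomial.X),
      shiftMatrix n Polynomial.X)
  rw [pairMap_clock_shift, hk] at hconj
  change SimConj (clockMatrix n (algebraMap k K ζ) s, shiftMatrix n y) C at hconj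
  have hfix (g : K →ₐ[k] K) (hg : SimConj (clockMatrix n (algebraMap k K ζ) s, shiftMatrix n y)
      (clockMatrix n (algebraMap k K ζ) (g s), shiftMatrix n (g y))) :
      pairMap (g : K →+* K) C = C := by
    refine (hC.eq_of_simConj huniq (hC.map g) (hconj.symm.trans (hg.trans ?_))).symm
    have := hconj.map (g : K →+* K)
    rw [pairMap_clock_shift] at this
    simpa using this
  have hσC : pairMap (σ : K →+* K) C = C := by
    refine hfix { (σ : K →+* K) with commutes' := hσk } ?_
    change SimConj _ (clockMatrix n _ (σ s), shiftMatrix n (σ y))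
    rw [hσs, hσy]
    exact simConj_clock_shift hζK.pow_eq_one s hy
  obtain ⟨f, hf, hnorm⟩ := exists_norm_eq_of_map_eq hζK hs σ (hσk ζ) hσs hconj hσC
  have hfL : f ∈ Set.range (algebraMap L K) := by
    rw [InfiniteGalois.mem_range_algebraMap_iff_fixed]
    intro g
    have hgR (P : R) : g (algebraMap R K P) = algebraMap R K P := by
      rw [IsScalarTower.algebraMap_apply R L K, g.commutes]
    refine hf (g : K →+* K) (hfix ((g : K →ₐ[L] K).restrictScalars k) ?_) (hgR _)
    change SimConj _ (clockMatrix n _ (g s), shiftMatrix n (g y))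
    rw [show g s = s from hgR _, show g y = y from hgR _]
    exact ⟨1, 1, by simp, by simp, by simp⟩
  obtain ⟨l, rfl⟩ := hfL
  obtain ⟨P, Q, hQ, rfl⟩ := IsFractionRing.div_surjective (A := R) l
  rw [map_div₀, ← IsScalarTower.algebraMap_apply, ← IsScalarTower.algebraMap_apply] at hnorm
  exact prod_iterate_ne_X hn ζ hζ0 σ hσ (nonZeroDivisors.ne_zero hQ) hnorm
end

section
/- Let k be a field and let A, B be 2×2 matrices over k with trace(A) = 0 and trace(B) = 0. If A and B have a common eigenvector, i.e. there exist a nonzero vector v ∈ k² and scalars a, b ∈ k with Av = a·v and Bv = b·v, then (trace(AB))² = 4·det(A)·det(B). In particular, the polynomial g = X_1X_3(X_2² − 4X_1X_3) vanishes at the point (det A, trace(AB), det B). -/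
/-- The determinant of the commutator of two trace-zero `2 × 2` matrices. -/
theorem Matrix.det_commutator_fin_two_of_trace_eq_zero {R : Type*} [CommRing R]
    (A B : Matrix (Fin 2) (Fin 2) R) (hA : A.trace = 0) (hB : B.trace = 0) :
    (A * B - B * A).det = 4 * A.det * B.det - (A * B).trace ^ 2 := by
  rw [Matrix.trace_fin_two] at hA hB
  have hA' : A 1 1 = -A 0 0 := by linear_combination hA
  have hB' : B 1 1 = -B 0 0 := by linear_combination hB
  simp only [Matrix.det_fin_two, Matrix.trace_fin_two, Matrix.sub_apply, Matrix.mul_apply,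
    Fin.sum_univ_two, hA', hB']
  ring

open Matrix in
/-- The commutator of two matrices with a common eigenvector is singular. -/
theorem Matrix.det_commutator_eq_zero_of_common_eigenvector {n R : Type*} [Fintype n]
    [DecidableEq n] [CommRing R] [IsDomain R] {A B : Matrix n n R} {v : n → R} (hv : v ≠ 0)
    {a b : R} (hva : A *ᵥ v = a • v) (hvb : B *ᵥ v = b • v) :
    (A * B - B * A).det = 0 := by
  refine Matrix.exists_mulVec_eq_zero_iff.mp ⟨v, hv, ?_⟩
  rw [Matrix.sub_mulVec, ← Matrix.mulVec_mulVec, ← Matrix.mulVec_mulVec, hva, hvb,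
    Matrix.mulVec_smul, Matrix.mulVec_smul, hva, hvb, smul_comm, sub_self]

open Matrix in
/-- if two trace-zero `2 × 2` matrices `A, B` have a common eigenvector, then
`(trace (A*B))² = 4 · det A · det B`; in particular `g = X₁X₃(X₂² - 4X₁X₃)` vanishes at
`(det A, trace (A*B), det B)`. -/
theorem stmt8 {k : Type*} [Field k] (A B : Matrix (Fin 2) (Fin 2) k)
    (hA : A.trace = 0) (hB : B.trace = 0)
    (v : Fin 2 → k) (hv : v ≠ 0) (a b : k)
    (hva : A *ᵥ v = a • v) (hvb : B *ᵥ v = b • v) :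
    (A * B).trace ^ 2 = 4 * A.det * B.det ∧
    A.det * B.det * ((A * B).trace ^ 2 - 4 * A.det * B.det) = 0 := by
  have h : (A * B).trace ^ 2 = 4 * A.det * B.det := by
    linear_combination Matrix.det_commutator_fin_two_of_trace_eq_zero A B hA hB -
      Matrix.det_commutator_eq_zero_of_common_eigenvector hv hva hvb
  exact ⟨h, by rw [h, sub_self, mul_zero]⟩
end

section
/- Let k be an algebraically closed field. Let (A,B) and (A',B') be pairs of 2×2 matrices over k with trace(A) = trace(B) = trace(A') = trace(B') = 0, satisfying det A = det A', trace(AB) = trace(A'B'), det B = det B', and det(A)·det(B)·((trace(AB))² − 4·det(A)·det(B)) ≠ 0. Then the pairs are simultaneously conjugate: there exists T ∈ GL_2(k) with T^{-1}AT = A' and T^{-1}BT = B'. Conversely, det, trace(AB), det are invariant under simultaneous conjugation, so on the locus where X_1X_3(X_2² − 4X_1X_3) does not vanish, the fibres of the map (A,B) ↦ (det A, trace(AB), det B) are exactly the simultaneous-conjugation orbits. -/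
open Matrix in
/-- A generic pair of trace-zero `2 × 2` matrices is simultaneously conjugate to a normal form
that depends only on the invariants and a chosen eigenvalue `l` of `A`. -/
lemma exists_unit_mul_eq_normalForm {k : Type*} [Field k] (A B : Matrix (Fin 2) (Fin 2) k)
    (hA : A.trace = 0) (hB : B.trace = 0)
    (hg : (A * B).trace ^ 2 - 4 * A.det * B.det ≠ 0) (l : k) (hl : l ^ 2 = -A.det) :
    ∃ T : (Matrix (Fin 2) (Fin 2) k)ˣ,
      A * T = T * !![l, (A * B).trace; 0, -l] ∧ B * T = T * !![0, -B.det; 1, 0] := by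
  obtain ⟨a, b, c, d, rfl⟩ : ∃ a b c d, A = !![a, b; c, d] := ⟨_, _, _, _, eta_fin_two A⟩
  obtain ⟨p, q, r, s, rfl⟩ : ∃ p q r s, B = !![p, q; r, s] := ⟨_, _, _, _, eta_fin_two B⟩
  simp only [trace_fin_two_of] at hA hB
  obtain rfl : d = -a := by linear_combination hA
  obtain rfl : s = -p := by linear_combination hB
  simp only [det_fin_two_of, mul_fin_two, trace_fin_two_of] at hg hl ⊢
  obtain ⟨v, hv, hAv⟩ := exists_mulVec_eq_zero_iff.2
    (show (!![a - l, b; c, -a - l]).det = 0 by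
      rw [det_fin_two_of]; linear_combination hl)
  have e0 : (a - l) * v 0 + b * v 1 = 0 := by
    simpa [mulVec, dotProduct] using congrFun hAv 0
  have e1 : c * v 0 + (-a - l) * v 1 = 0 := by
    simpa [mulVec, dotProduct] using congrFun hAv 1
  have hv' : v 0 ≠ 0 ∨ v 1 ≠ 0 := by
    by_contra! h
    exact hv (by ext i; fin_cases i <;> simp [h])
  generalize v 0 = x at *
  generalize v 1 = y at *
  have hT : IsUnit !![x, p * x + q * y; y, r * x - p * y] := by
    rw [isUnit_iff_isUnit_det, det_fin_two_of, isUnit_iff_ne_zero]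
    intro h
    apply hg
    obtain ⟨m, g0, g1⟩ : ∃ m, p * x + q * y = m * x ∧ r * x - p * y = m * y := by
      rcases hv' with hx | hy
      · refine ⟨(p * x + q * y) / x, by field_simp, ?_⟩
        field_simp
        linear_combination h
      · refine ⟨(r * x - p * y) / y, ?_, by field_simp⟩
        field_simp
        linear_combination -h
    have f0 : (b * r - q * c) * x + 2 * (a * q - b * p) * y = 0 := by
      linear_combination (a - l) * g0 + b * g1 + (m - p) * e0 - q * e1
    have f1 : 2 * (c * p - a * r) * x - (b * r - q * c) * y = 0 := by
      linear_combination c * g0 - (a + l) * g1 + (m + p) * e1 - r * e0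
    rcases hv' with hx | hy
    · apply mul_left_cancel₀ hx
      linear_combination (b * r - q * c) * f0 + 2 * (a * q - b * p) * f1
    · apply mul_left_cancel₀ hy
      linear_combination 2 * (c * p - a * r) * f0 - (b * r - q * c) * f1
  refine ⟨hT.unit, ?_, ?_⟩ <;> rw [IsUnit.unit_spec, mul_fin_two, mul_fin_two] <;>
    ext i j <;> fin_cases i <;> fin_cases j <;>
    simp only [Fin.zero_eta, Fin.mk_one, of_apply, cons_val_zero, cons_val_one]
  · linear_combination e0
  · linear_combination -p * e0 - q * e1
  · linear_combination e1
  · linear_combination p * e1 - r * e0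
  all_goals ring

/-- over an algebraically closed field, two pairs of trace-zero `2 × 2`
matrices with the same invariants `(det A, trace (A*B), det B)`, on the locus where
`X₁X₃(X₂² - 4X₁X₃)` does not vanish, are simultaneously conjugate; conversely these
invariants are constant on simultaneous-conjugation orbits. -/
theorem stmt9 {k : Type*} [Field k] [IsAlgClosed k]
    (A B A' B' : Matrix (Fin 2) (Fin 2) k)
    (hA : A.trace = 0) (hB : B.trace = 0) (hA' : A'.trace = 0) (hB' : B'.trace = 0)
    (h1 : A.det = A'.det) (h2 : (A * B).trace = (A' * B').trace) (h3 : B.det = B'.det)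
    (hg : A.det * B.det * ((A * B).trace ^ 2 - 4 * A.det * B.det) ≠ 0) :
    (∃ T : (Matrix (Fin 2) (Fin 2) k)ˣ,
      (↑T⁻¹ : Matrix (Fin 2) (Fin 2) k) * A * (↑T : Matrix (Fin 2) (Fin 2) k) = A' ∧
      (↑T⁻¹ : Matrix (Fin 2) (Fin 2) k) * B * (↑T : Matrix (Fin 2) (Fin 2) k) = B') ∧
    -- conversely, the invariants are invariant under simultaneous conjugation
    (∀ (C D : Matrix (Fin 2) (Fin 2) k) (T : (Matrix (Fin 2) (Fin 2) k)ˣ),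
      ((↑T⁻¹ : Matrix (Fin 2) (Fin 2) k) * C * (↑T : Matrix (Fin 2) (Fin 2) k)).det = C.det ∧
      (((↑T⁻¹ : Matrix (Fin 2) (Fin 2) k) * C * (↑T : Matrix (Fin 2) (Fin 2) k)) *
        ((↑T⁻¹ : Matrix (Fin 2) (Fin 2) k) * D * (↑T : Matrix (Fin 2) (Fin 2) k))).trace =
        (C * D).trace ∧
      ((↑T⁻¹ : Matrix (Fin 2) (Fin 2) k) * D * (↑T : Matrix (Fin 2) (Fin 2) k)).det = D.det) := by
  refine ⟨?_, fun C D T => ⟨?_, ?_, ?_⟩⟩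
  · obtain ⟨l, hl⟩ := IsAlgClosed.exists_pow_nat_eq (-A.det) two_pos
    have hd := right_ne_zero_of_mul hg
    obtain ⟨S, hSA, hSB⟩ := exists_unit_mul_eq_normalForm A B hA hB hd l hl
    obtain ⟨S', hSA', hSB'⟩ :=
      exists_unit_mul_eq_normalForm A' B' hA' hB' (by rwa [← h1, ← h2, ← h3]) l (by rw [hl, h1])
    rw [← h2] at hSA'
    rw [← h3] at hSB'
    have conj_of_mul_eq {M M' N : Matrix (Fin 2) (Fin 2) k} (h : M * S = S * N)
        (h' : M' * S' = S' * N) : (↑(S * S'⁻¹)⁻¹ : Matrix (Fin 2) (Fin 2) k) * M *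
          (↑(S * S'⁻¹) : Matrix (Fin 2) (Fin 2) k) = M' := by
      rw [mul_inv_rev, inv_inv, Units.val_mul, Units.val_mul, mul_assoc, ← mul_assoc M, h]
      simp [← mul_assoc, ← h']
    exact ⟨S * S'⁻¹, conj_of_mul_eq hSA hSA', conj_of_mul_eq hSB hSB'⟩
  · exact Matrix.det_units_conj' T C
  · rw [show (↑T⁻¹ : Matrix (Fin 2) (Fin 2) k) * C * ↑T * (↑T⁻¹ * D * ↑T) = ↑T⁻¹ * (C * D) * ↑T by
      simp [mul_assoc]]
    exact Matrix.trace_units_conj' T (C * D)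
  · exact Matrix.det_units_conj' T D
end

section
/- Let k be an algebraically closed field and let (x_1, x_2, x_3) ∈ k³ satisfy x_1·x_3·(x_2² − 4x_1x_3) ≠ 0. Consider the set S of triples (a, b, c) ∈ k³ such that a·b·c·(4ab + c) ≠ 0 and (−a², 2ab + c, −b²) = (x_1, x_2, x_3); equivalently, S is the set of pairs in Q lying over (x_1,x_2,x_3), where Q consists of the pairs A = [[a, 1], [0, −a]], B = [[b, 0], [c, −b]] with a·b·c·(4ab+c) ≠ 0, and the map is (A,B) ↦ (det A, trace(AB), det B). Then S has exactly 4 elements if char k ≠ 2, and exactly 1 element if char k = 2. -/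
/-- A nonzero element and its negative form a set of one or two elements, according to whether
the characteristic is `2`. -/
theorem ncard_pair_neg {k : Type*} [Field k] {p : k} (hp : p ≠ 0) :
    ({p, -p} : Set k).ncard = if ringChar k = 2 then 1 else 2 := by
  split_ifs with h
  · have : CharP k 2 := ringChar.of_eq h
    simp [CharTwo.neg_eq]
  · exact Set.ncard_pair fun he => hp ((Ring.eq_self_iff_eq_zero_of_char_ne_two h).1 he.symm)

/-- The fibre over `(-p², x₂, -q²)` is a graph over the pairs `(±p, ±q)`. -/
theorem fibre_eq_image {k : Type*} [Field k] (p q x₂ : k)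
    (hx : -p ^ 2 * -q ^ 2 * (x₂ ^ 2 - 4 * -p ^ 2 * -q ^ 2) ≠ 0) :
    {w : k × k × k | w.1 * w.2.1 * w.2.2 * (4 * w.1 * w.2.1 + w.2.2) ≠ 0 ∧
        -w.1 ^ 2 = -p ^ 2 ∧ 2 * w.1 * w.2.1 + w.2.2 = x₂ ∧ -w.2.1 ^ 2 = -q ^ 2} =
      (fun v : k × k => (v.1, v.2, x₂ - 2 * v.1 * v.2)) '' (({p, -p} : Set k) ×ˢ {q, -q}) := by
  ext ⟨a, b, c⟩
  simp only [Set.mem_ofPred_eq, Set.mem_image, Set.mem_prod, Set.mem_insert_iff,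
    Set.mem_singleton_iff, Prod.exists, Prod.mk.injEq, neg_inj, sq_eq_sq_iff_eq_or_eq_neg]
  constructor
  · rintro ⟨-, ha, rfl, hb⟩
    exact ⟨a, b, ⟨ha, hb⟩, rfl, rfl, by ring⟩
  · rintro ⟨a, b, ⟨ha, hb⟩, rfl, rfl, rfl⟩
    refine ⟨fun h => hx ?_, ha, by ring, hb⟩
    rw [← sq_eq_sq_iff_eq_or_eq_neg] at ha hb
    rw [← ha, ← hb]
    linear_combination a * b * h

/-- over an algebraically closed field `k`, given `(x₁, x₂, x₃) ∈ k³` with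
`x₁x₃(x₂² - 4x₁x₃) ≠ 0`, the set of triples `(a, b, c)` with `abc(4ab + c) ≠ 0` and
`(-a², 2ab + c, -b²) = (x₁, x₂, x₃)` (i.e. the elements of `Q` lying over `(x₁,x₂,x₃)`
under `(A,B) ↦ (det A, trace (A*B), det B)`) has exactly `4` elements if `char k ≠ 2` and
exactly `1` element if `char k = 2`. -/
theorem stmt10 {k : Type*} [Field k] [IsAlgClosed k] (x₁ x₂ x₃ : k)
    (hx : x₁ * x₃ * (x₂ ^ 2 - 4 * x₁ * x₃) ≠ 0) :
    {w : k × k × k | w.1 * w.2.1 * w.2.2 * (4 * w.1 * w.2.1 + w.2.2) ≠ 0 ∧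
        -w.1 ^ 2 = x₁ ∧ 2 * w.1 * w.2.1 + w.2.2 = x₂ ∧ -w.2.1 ^ 2 = x₃}.ncard =
      if ringChar k = 2 then 1 else 4 := by
  obtain ⟨p, hp⟩ := IsAlgClosed.exists_pow_nat_eq (-x₁) two_pos
  obtain ⟨q, hq⟩ := IsAlgClosed.exists_pow_nat_eq (-x₃) two_pos
  obtain rfl : x₁ = -p ^ 2 := by rw [hp, neg_neg]
  obtain rfl : x₃ = -q ^ 2 := by rw [hq, neg_neg]
  have hp0 : p ≠ 0 := by rintro rfl; simp at hx
  have hq0 : q ≠ 0 := by rintro rfl; simp at hx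
  rw [fibre_eq_image p q x₂ hx, Set.ncard_image_of_injective, Set.ncard_prod,
    ncard_pair_neg hp0, ncard_pair_neg hq0]
  · split_ifs <;> rfl
  · rintro ⟨a, b⟩ ⟨c, d⟩ h
    simp only [Prod.mk.injEq] at h ⊢
    exact ⟨h.1, h.2.1⟩
end

section
/- Let k be a field. There do not exist polynomials Q, P_{11}, P_{12}, P_{21} in the polynomial ring k[X_1, X_2, X_3] with Q ≠ 0 such that both Q·X_2 = −X_1·P_{21} + P_{12} and Q²·X_3 = −P_{11}² − P_{12}·P_{21} hold. Consequently there is no rational local section of the map sending a trace-zero pair of 2×2 matrices (A,B) to (det A, trace(AB), det B). -/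
open MvPolynomial MonomialOrder in
/-- The lexicographic degree of `X i * f ^ 2` is twice that of `f`, plus the `i`-th unit vector. -/
lemma lex_degree_X_mul_sq {k : Type*} [Field k] (i : Fin 3) {f : MvPolynomial (Fin 3) k}
    (hf : f ≠ 0) :
    lex.degree (X i * f ^ 2) = Finsupp.single i 1 + 2 • lex.degree f := by
  rw [degree_mul (X_ne_zero i) (pow_ne_zero 2 hf), degree_X, degree_pow]

open MvPolynomial MonomialOrder in
/-- The ternary quadratic form `r² + X₁ p² + X₂ p q + X₃ q²` has no zero with `q ≠ 0`. -/
lemma neg_sq_ne_of_ne_zero {k : Type*} [Field k] {p q : MvPolynomial (Fin 3) k} (hq : q ≠ 0)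
    (r : MvPolynomial (Fin 3) k) :
    X 0 * p ^ 2 + X 2 * q ^ 2 + X 1 * (p * q) ≠ -r ^ 2 := by
  intro h
  have hr : lex.degree (-r ^ 2) = 2 • lex.degree r := by rw [degree_neg, degree_pow]
  have dB := lex_degree_X_mul_sq 2 hq
  by_cases hp : p = 0
  · subst hp
    simp only [ne_eq, OfNat.ofNat_ne_zero, not_false_eq_true, zero_pow, mul_zero, zero_add,
      zero_mul, add_zero] at h
    rw [h, hr] at dB
    have := DFunLike.congr_fun dB 2
    simp at this
    omega
  have dA := lex_degree_X_mul_sq 0 hp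
  have dM : lex.degree (X 1 * (p * q)) =
      Finsupp.single 1 1 + (lex.degree p + lex.degree q) := by
    rw [degree_mul (X_ne_zero 1) (mul_ne_zero hp hq), degree_X, degree_mul hp hq]
  set A := X 0 * p ^ 2
  set B := X 2 * q ^ 2
  set M := X 1 * (p * q)
  have hmid : lex.toSyn (lex.degree M) + lex.toSyn (lex.degree M) <
      lex.toSyn (lex.degree A) + lex.toSyn (lex.degree B) := by
    rw [← map_add, ← map_add, lex_lt_iff, dA, dB, dM]
    refine Finsupp.Lex.lt_iff.mpr ⟨0, fun j hj => absurd hj (Fin.not_lt_zero j), ?_⟩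
    simp
    omega
  have hne : lex.degree A ≠ lex.degree B := by
    rw [dA, dB]
    intro e
    have := DFunLike.congr_fun e 0
    simp at this
    omega
  rcases lt_or_gt_of_ne (lex.toSyn.injective.ne hne) with hlt | hlt
  · have hM : lex.toSyn (lex.degree M) < lex.toSyn (lex.degree B) := by
      by_contra! hc
      exact (hmid.trans_le (add_le_add (hlt.le.trans hc) hc)).false
    have hAB := degree_add_eq_right_of_lt hlt
    have hd := degree_add_of_lt (hM.trans_eq (congrArg _ hAB.symm))
    rw [h, hr, hAB, dB] at hd
    have := DFunLike.congr_fun hd 2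
    simp at this
    omega
  · have hM : lex.toSyn (lex.degree M) < lex.toSyn (lex.degree A) := by
      by_contra! hc
      exact (hmid.trans_le (add_le_add hc (hlt.le.trans hc))).false
    have hAB := degree_add_of_lt hlt
    have hd := degree_add_of_lt (hM.trans_eq (congrArg _ hAB.symm))
    rw [h, hr, hAB, dA] at hd
    have := DFunLike.congr_fun hd 0
    simp at this
    omega

open MvPolynomial in
/-- there are no polynomials `Q ≠ 0`, `P₁₁`, `P₁₂`, `P₂₁` in `k[X₁,X₂,X₃]`
with `Q·X₂ = -X₁·P₂₁ + P₁₂` and `Q²·X₃ = -P₁₁² - P₁₂·P₂₁` (here `X₁ = X 0`, `X₂ = X 1`,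
`X₃ = X 2`).  Consequently the map `(A,B) ↦ (det A, trace (A*B), det B)` on trace-zero
pairs of `2 × 2` matrices has no rational local section. -/
theorem stmt11 {k : Type*} [Field k] :
    ¬ ∃ (Q P₁₁ P₁₂ P₂₁ : MvPolynomial (Fin 3) k),
      Q ≠ 0 ∧
      Q * X 1 = -X 0 * P₂₁ + P₁₂ ∧
      Q ^ 2 * X 2 = -P₁₁ ^ 2 - P₁₂ * P₂₁ := by
  rintro ⟨Q, R, P₁₂, P, hQ, h₁, h₂⟩
  refine neg_sq_ne_of_ne_zero (p := P) hQ R ?_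
  linear_combination h₂ + P * h₁
end

section
/- Let k be a field of characteristic 0 and n ≥ 1. Let D be the n×n diagonal matrix with diagonal entries 1, 2, …, n, and let P be the n×n permutation matrix of the n-cycle (sending the i-th standard basis vector e_i to e_{i+1} for i < n and e_n to e_1). Then the only k-linear subspaces W of k^n satisfying D·W ⊆ W and P·W ⊆ W are W = 0 and W = k^n. Equivalently, the k⟨X_1, X_2⟩-module structure on k^n in which X_1 acts by D and X_2 acts by P is a simple module. -/
open Matrix in
/-- A subspace invariant under a diagonal matrix with entries `d` is invariant under coordinatewise
multiplication by `∏ j ∈ s, (d i - d j)`. -/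
theorem prod_sub_mul_mem_of_diagonal_mulVec_mem {k ι : Type*} [Field k] [Fintype ι]
    [DecidableEq ι] {d : ι → k} {W : Submodule k (ι → k)}
    (hW : ∀ w ∈ W, diagonal d *ᵥ w ∈ W) {w : ι → k} (hw : w ∈ W) (s : Finset ι) :
    (fun i => (∏ j ∈ s, (d i - d j)) * w i) ∈ W := by
  induction s using Finset.induction_on with
  | empty => simpa using hw
  | insert a s ha ih =>
    convert W.sub_mem (hW _ ih) (W.smul_mem (d a) ih) using 1
    ext i
    simp only [Finset.prod_insert ha, Pi.sub_apply, Pi.smul_apply, smul_eq_mul, mulVec_diagonal]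
    ring

open Matrix in
/-- A subspace invariant under a diagonal matrix with distinct entries contains every standard basis
vector on which one of its elements is supported. -/
theorem single_mem_of_diagonal_mulVec_mem {k ι : Type*} [Field k] [Fintype ι]
    [DecidableEq ι] {d : ι → k} (hd : Function.Injective d) {W : Submodule k (ι → k)}
    (hW : ∀ w ∈ W, diagonal d *ᵥ w ∈ W) {w : ι → k} (hw : w ∈ W) {i : ι} (hi : w i ≠ 0) :
    Pi.single i (1 : k) ∈ W := by
  have hc : (∏ j ∈ Finset.univ.erase i, (d i - d j)) * w i ≠ 0 :=
    mul_ne_zero (Finset.prod_ne_zero_iff.mpr fun j hj =>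
      sub_ne_zero.mpr fun h => Finset.ne_of_mem_erase hj (hd h).symm) hi
  convert W.smul_mem ((∏ j ∈ Finset.univ.erase i, (d i - d j)) * w i)⁻¹
    (prod_sub_mul_mem_of_diagonal_mulVec_mem hW hw (Finset.univ.erase i)) using 1
  ext l
  rcases eq_or_ne l i with rfl | hl
  · simp only [Pi.single_eq_same, Pi.smul_apply, smul_eq_mul]
    exact (inv_mul_cancel₀ hc).symm
  · have h0 : ∏ j ∈ Finset.univ.erase i, (d l - d j) = 0 :=
      Finset.prod_eq_zero (Finset.mem_erase.mpr ⟨hl, Finset.mem_univ l⟩) (sub_self _)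
    simp [hl, h0]

open Matrix in
/-- over a field of characteristic `0`, the diagonal matrix
`D = diag(1, 2, …, n)` and the permutation matrix `P` of the `n`-cycle (`P eⱼ = e_{j+1}`
cyclically) have no common invariant subspace other than `0` and `kⁿ`; i.e. the
`k⟨X₁,X₂⟩`-module structure on `kⁿ` where `X₁` acts by `D` and `X₂` by `P` is simple. -/
theorem stmt15 {k : Type*} [Field k] [CharZero k] (n : ℕ) (hn : 1 ≤ n)
    (D : Matrix (Fin n) (Fin n) k) (hD : D = Matrix.diagonal fun i : Fin n => ((i : ℕ) + 1 : k))
    (P : Matrix (Fin n) (Fin n) k)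
    (hP : P = Matrix.of fun i j => if i = finRotate n j then (1 : k) else 0) :
    ∀ W : Submodule k (Fin n → k),
      (∀ w ∈ W, D *ᵥ w ∈ W) → (∀ w ∈ W, P *ᵥ w ∈ W) → W = ⊥ ∨ W = ⊤ := by
  intro W hDW hPW
  subst hD hP
  obtain ⟨m, rfl⟩ : ∃ m, n = m + 1 := ⟨n - 1, by omega⟩
  refine or_iff_not_imp_left.mpr fun hW => ?_
  obtain ⟨w, hw, hw0⟩ := W.ne_bot_iff.mp hW
  obtain ⟨i, hi⟩ := Function.ne_iff.mp hw0
  have hd : Function.Injective fun i : Fin (m + 1) => ((i : ℕ) + 1 : k) := fun a b h =>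
    Fin.ext (Nat.cast_injective (add_right_cancel h))
  have hsingle : ∀ t : Fin (m + 1), Pi.single (i + t) (1 : k) ∈ W := by
    intro t
    induction t using Fin.induction with
    | zero => simpa using single_mem_of_diagonal_mulVec_mem hd hDW hw hi
    | succ t ih =>
      convert hPW _ ih using 1
      ext l
      simp [Pi.single_apply, add_assoc, ← Fin.coeSucc_eq_succ]
  refine eq_top_iff.mpr fun v _ => ?_
  rw [pi_eq_sum_univ' v]
  refine W.sum_mem fun j _ => W.smul_mem _ ?_
  convert hsingle (j - i) using 1
  ext l
  simp [Pi.single_apply, eq_comm]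
end

section
/- Let R be a ring and let S, T, T' be R-modules with Hom_R(S, T) = 0 and Hom_R(S, T') = 0. If the direct sums S ⊕ T and S ⊕ T' are isomorphic as R-modules, then T and T' are isomorphic as R-modules. In particular, for matrices: if s ⊕ t and s ⊕ t' are block-diagonal matrices whose associated modules satisfy these Hom-vanishing conditions, then s ⊕ t is similar to s ⊕ t' if and only if t is similar to t'. -/
/-- If `e.symm` maps `S` into `S`, then the `T`-to-`T'` block of `e` is a right inverse of the
`T'`-to-`T` block of `e.symm`. -/
theorem LinearEquiv.snd_symm_comp_snd_eq_id {R S T T' : Type*} [Ring R]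
    [AddCommGroup S] [Module R S] [AddCommGroup T] [Module R T]
    [AddCommGroup T'] [Module R T'] (e : (S × T) ≃ₗ[R] (S × T'))
    (h : LinearMap.snd R S T ∘ₗ e.symm.toLinearMap ∘ₗ LinearMap.inl R S T' = 0) :
    (LinearMap.snd R S T ∘ₗ e.symm.toLinearMap ∘ₗ LinearMap.inr R S T') ∘ₗ
      (LinearMap.snd R S T' ∘ₗ e.toLinearMap ∘ₗ LinearMap.inr R S T) = LinearMap.id := by
  refine LinearMap.ext fun t => ?_
  have hS : (e.symm ((e (0, t)).1, 0)).2 = 0 := LinearMap.congr_fun h (e (0, t)).1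
  have hsplit : e (0, t) = ((e (0, t)).1, 0) + (0, (e (0, t)).2) := by simp
  have ht := congrArg (fun x => (e.symm x).2) hsplit
  simp only [LinearEquiv.symm_apply_apply, map_add, Prod.snd_add, hS, zero_add] at ht
  exact ht.symm

/-- if `R`-modules `S, T, T'` satisfy `Hom_R(S, T) = 0` and
`Hom_R(S, T') = 0`, and `S ⊕ T ≅ S ⊕ T'` as `R`-modules, then `T ≅ T'` as `R`-modules. -/
theorem stmt17 {R : Type*} [Ring R] (S T T' : Type*)
    [AddCommGroup S] [Module R S] [AddCommGroup T] [Module R T]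
    [AddCommGroup T'] [Module R T']
    (hST : ∀ f : S →ₗ[R] T, f = 0) (hST' : ∀ f : S →ₗ[R] T', f = 0)
    (h : Nonempty ((S × T) ≃ₗ[R] (S × T'))) :
    Nonempty (T ≃ₗ[R] T') := by
  obtain ⟨e⟩ := h
  exact ⟨LinearEquiv.ofLinearMap _ _
    (e.symm.snd_symm_comp_snd_eq_id (hST' _)) (e.snd_symm_comp_snd_eq_id (hST _))⟩
end
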